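/- Let $A_n$ be an $n \times N$ real random matrix whose rows $r_1, \ldots, r_n$ satisfy the $\beta_n$-dependence condition: $\sigma(r_{i_1},\ldots,r_{i_k})$ and $\sigma(r_{j_1},\ldots,r_{j_m})$ are independent whenever all indices satisfy $|i_l - j_p| > \beta_n$. Then there exists an absolute constant $C > 0$ such that for every $z$ with $\operatorname{Im} z \ne 0$, $\operatorname{Var}\left[ \frac{1}{n} \operatorname{Tr}\left( \frac{1}{n} A_n A_n^T - zI_n \right)^{-1} \right] \le \frac{C (\beta_n + 1)^2}{n |\operatorname{Im} z|^2}$. -/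

import Mathlib

open MeasureTheory ProbabilityTheory Matrix

theorem LinearMap.norm_trace_le_finrank_range_mul {𝕜 E : Type*} [RCLike 𝕜]
    [NormedAddCommGroup E] [InnerProductSpace 𝕜 E] [FiniteDimensional 𝕜 E]
    (T : E →ₗ[𝕜] E) {c : ℝ} (hT : ∀ x, ‖T x‖ ≤ c * ‖x‖) :
    ‖LinearMap.trace 𝕜 E T‖ ≤ Module.finrank 𝕜 (LinearMap.range T) * c := by
  have hmem : ∀ x, T x ∈ LinearMap.range T := fun x => ⟨x, rfl⟩
  rw [← LinearMap.trace_restrict_eq_of_forall_mem (LinearMap.range T) T hmem,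
    LinearMap.trace_eq_sum_inner _ (stdOrthonormalBasis 𝕜 (LinearMap.range T))]
  refine (norm_sum_le _ _).trans ?_
  refine (Finset.sum_le_card_nsmul _ _ c fun i _ => ?_).trans (by simp)
  refine (norm_inner_le_norm _ _).trans ?_
  rw [OrthonormalBasis.norm_eq_one, one_mul]
  refine (hT _).trans ?_
  have h1 : ‖(LinearMap.range T).subtype (stdOrthonormalBasis 𝕜 (LinearMap.range T) i)‖ = 1 :=
    (stdOrthonormalBasis 𝕜 (LinearMap.range T)).norm_eq_one i
  rw [h1, mul_one]

theorem Matrix.norm_trace_le_rank_mul {𝕜 ι : Type*} [RCLike 𝕜] [Fintype ι] [DecidableEq ι]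
    (K : Matrix ι ι 𝕜) {c : ℝ} (hK : ∀ x, ‖K.toEuclideanLin x‖ ≤ c * ‖x‖) :
    ‖K.trace‖ ≤ K.rank * c := by
  have h := LinearMap.norm_trace_le_finrank_range_mul K.toEuclideanLin hK
  have he : K.toEuclideanLin = Matrix.toLin (PiLp.basisFun 2 𝕜 ι) (PiLp.basisFun 2 𝕜 ι) K := by
    rw [← Matrix.toLpLin_eq_toLin]
  rw [he, Matrix.trace_toLin_eq,
    ← Matrix.rank_eq_finrank_range_toLin] at h
  exact h

theorem Matrix.IsHermitian.abs_im_mul_norm_le {ι : Type*} [Fintype ι] [DecidableEq ι]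
    {M : Matrix ι ι ℂ} (hM : M.IsHermitian) (z : ℂ) (x : EuclideanSpace ℂ ι) :
    |z.im| * ‖x‖ ≤ ‖(M - z • (1 : Matrix ι ι ℂ)).toEuclideanLin x‖ := by
  have hs : M.toEuclideanLin.IsSymmetric := isSymmetric_toEuclideanLin_iff.mpr hM
  have h0 : (inner ℂ x (M.toEuclideanLin x)).im = 0 := hs.im_inner_self_apply x
  have h1 : (M - z • (1 : Matrix ι ι ℂ)).toEuclideanLin x = M.toEuclideanLin x - z • x := by
    simp [map_sub, map_smul]
  have h2 : (inner ℂ x (M.toEuclideanLin x - z • x)).im = - (z.im * ‖x‖ ^ 2) := by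
    rw [inner_sub_right, inner_smul_right, inner_self_eq_norm_sq_to_K, Complex.sub_im, h0]
    simp [← Complex.ofReal_pow]
  have h3 : |z.im| * ‖x‖ ^ 2 ≤ ‖x‖ * ‖M.toEuclideanLin x - z • x‖ := by
    have := (Complex.abs_im_le_norm _).trans (norm_inner_le_norm (𝕜 := ℂ) x (M.toEuclideanLin x - z • x))
    rwa [h2, abs_neg, abs_mul, abs_of_nonneg (sq_nonneg ‖x‖)] at this
  rw [h1]
  rcases (norm_nonneg x).eq_or_lt with h | h
  · rw [← h, mul_zero]; exact norm_nonneg _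
  · nlinarith

theorem Matrix.IsHermitian.isUnit_sub_smul_one {ι : Type*} [Fintype ι] [DecidableEq ι]
    {M : Matrix ι ι ℂ} (hM : M.IsHermitian) {z : ℂ} (hz : z.im ≠ 0) :
    IsUnit (M - z • (1 : Matrix ι ι ℂ)) := by
  rw [← Matrix.mulVec_injective_iff_isUnit]
  intro v w hvw
  have h := hM.abs_im_mul_norm_le z (WithLp.toLp 2 (v - w))
  rw [Matrix.toLpLin_toLp, Matrix.toLin'_apply, Matrix.mulVec_sub, hvw, sub_self] at h
  have h' : ‖WithLp.toLp 2 (v - w)‖ = 0 := by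
    have := abs_pos.mpr hz
    simp only [WithLp.toLp_zero, norm_zero] at h
    nlinarith [norm_nonneg (WithLp.toLp 2 (v - w) : EuclideanSpace ℂ ι)]
  simpa [sub_eq_zero] using h'

theorem Matrix.IsHermitian.norm_resolvent_apply_le {ι : Type*} [Fintype ι] [DecidableEq ι]
    {M : Matrix ι ι ℂ} (hM : M.IsHermitian) {z : ℂ} (hz : z.im ≠ 0) (x : EuclideanSpace ℂ ι) :
    ‖(M - z • (1 : Matrix ι ι ℂ))⁻¹.toEuclideanLin x‖ ≤ |z.im|⁻¹ * ‖x‖ := by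
  have h := hM.abs_im_mul_norm_le z ((M - z • (1 : Matrix ι ι ℂ))⁻¹.toEuclideanLin x)
  have hdet := (Matrix.isUnit_iff_isUnit_det _).mp (hM.isUnit_sub_smul_one hz)
  have h1 : (M - z • (1 : Matrix ι ι ℂ)).toEuclideanLin
      ((M - z • (1 : Matrix ι ι ℂ))⁻¹.toEuclideanLin x) = x := by
    rw [Matrix.toLpLin_apply, Matrix.toLpLin_apply, Matrix.mulVec_mulVec,
      Matrix.mul_nonsing_inv _ hdet, Matrix.one_mulVec]
  rw [h1] at h
  rw [inv_mul_eq_div, le_div_iff₀ (abs_pos.mpr hz), mul_comm]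
  exact h

theorem Matrix.IsHermitian.norm_trace_resolvent_le {ι : Type*} [Fintype ι] [DecidableEq ι]
    {M : Matrix ι ι ℂ} (hM : M.IsHermitian) {z : ℂ} (hz : z.im ≠ 0) :
    ‖(M - z • (1 : Matrix ι ι ℂ))⁻¹.trace‖ ≤ Fintype.card ι * |z.im|⁻¹ := by
  refine (Matrix.norm_trace_le_rank_mul _ (hM.norm_resolvent_apply_le hz)).trans ?_
  gcongr
  exact Matrix.rank_le_card_width _

theorem Matrix.IsHermitian.norm_trace_resolvent_sub_le {ι : Type*} [Fintype ι] [DecidableEq ι]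
    {M M' : Matrix ι ι ℂ} (hM : M.IsHermitian) (hM' : M'.IsHermitian) {z : ℂ} (hz : z.im ≠ 0) :
    ‖(M - z • (1 : Matrix ι ι ℂ))⁻¹.trace - (M' - z • (1 : Matrix ι ι ℂ))⁻¹.trace‖ ≤
      (M' - M).rank * (2 * |z.im|⁻¹) := by
  have hr : (M - z • (1 : Matrix ι ι ℂ))⁻¹ - (M' - z • (1 : Matrix ι ι ℂ))⁻¹ =
      (M - z • (1 : Matrix ι ι ℂ))⁻¹ * (M' - M) * (M' - z • (1 : Matrix ι ι ℂ))⁻¹ := by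
    have h1 := Matrix.nonsing_inv_mul _
      ((Matrix.isUnit_iff_isUnit_det _).mp (hM.isUnit_sub_smul_one hz))
    have h2 := Matrix.mul_nonsing_inv _
      ((Matrix.isUnit_iff_isUnit_det _).mp (hM'.isUnit_sub_smul_one hz))
    have h3 : M' - M = (M' - z • (1 : Matrix ι ι ℂ)) - (M - z • (1 : Matrix ι ι ℂ)) := by abel
    rw [h3, Matrix.mul_sub, Matrix.sub_mul, h1, Matrix.mul_assoc, h2, Matrix.mul_one,
      Matrix.one_mul]
  rw [← Matrix.trace_sub]
  refine (Matrix.norm_trace_le_rank_mul (c := 2 * |z.im|⁻¹) _ fun x => ?_).trans ?_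
  · rw [map_sub, LinearMap.sub_apply]
    refine (norm_sub_le _ _).trans ?_
    linarith [hM.norm_resolvent_apply_le hz x, hM'.norm_resolvent_apply_le hz x]
  · rw [hr]
    gcongr
    exact (Matrix.rank_mul_le_left _ _).trans (Matrix.rank_mul_le_right _ _)

theorem Matrix.rank_le_card_of_row_eq_zero {𝕜 ι κ : Type*} [Field 𝕜] [Fintype ι]
    [Fintype κ] [DecidableEq ι] (B : Matrix ι κ 𝕜) (s : Finset ι) (h : ∀ i ∉ s, B i = 0) :
    B.rank ≤ s.card := by
  classical
  have hB : B = Matrix.diagonal (fun i => if i ∈ s then (1 : 𝕜) else 0) * B := by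
    ext i j
    rw [Matrix.diagonal_mul]
    split_ifs with hi
    · rw [one_mul]
    · rw [h i hi]; simp
  rw [hB]
  refine (Matrix.rank_mul_le_left _ _).trans ?_
  rw [Matrix.rank_diagonal]
  simp [Fintype.card_subtype]

theorem Matrix.rank_add_le {𝕜 ι κ : Type*} [Field 𝕜] [Fintype ι] [Fintype κ]
    (A B : Matrix ι κ 𝕜) : (A + B).rank ≤ A.rank + B.rank := by
  rw [Matrix.rank, Matrix.mulVecLin_add]
  refine (Submodule.finrank_mono ?_).trans (Submodule.finrank_add_le_finrank_add_finrank
    (LinearMap.range A.mulVecLin) (LinearMap.range B.mulVecLin))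
  rintro _ ⟨v, rfl⟩
  exact Submodule.add_mem_sup ⟨v, rfl⟩ ⟨v, rfl⟩

theorem Matrix.rank_mul_transpose_sub_le {𝕜 ι κ : Type*} [Field 𝕜] [Fintype ι]
    [Fintype κ] [DecidableEq ι] (A B : Matrix ι κ 𝕜) (s : Finset ι) (h : ∀ i ∉ s, A i = B i) :
    (A * Aᵀ - B * Bᵀ).rank ≤ 2 * s.card := by
  have hr : (A - B).rank ≤ s.card :=
    Matrix.rank_le_card_of_row_eq_zero _ s fun i hi => by
      ext j
      simp [h i hi]
  have he : A * Aᵀ - B * Bᵀ = (A - B) * Aᵀ + B * (A - B)ᵀ := by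
    rw [Matrix.transpose_sub, Matrix.sub_mul, Matrix.mul_sub]; abel
  rw [he, two_mul]
  refine (Matrix.rank_add_le _ _).trans (add_le_add ?_ ?_)
  · exact (Matrix.rank_mul_le_left _ _).trans hr
  · refine (Matrix.rank_mul_le_right _ _).trans ?_
    rwa [Matrix.rank_transpose]

/-- The Stieltjes transform at `z` of the empirical spectral distribution of `A * Aᵀ / n`. -/
noncomputable def sampleStieltjes {n N : ℕ} (z : ℂ) (A : Matrix (Fin n) (Fin N) ℝ) : ℂ :=
  ((n : ℂ))⁻¹ * (((n : ℂ))⁻¹ • ((A * Aᵀ).map Complex.ofReal)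
    - z • (1 : Matrix (Fin n) (Fin n) ℂ))⁻¹.trace

theorem isHermitian_smul_map_mul_transpose {n N : ℕ} (A : Matrix (Fin n) (Fin N) ℝ) :
    (((n : ℂ))⁻¹ • ((A * Aᵀ).map Complex.ofReal)).IsHermitian := by
  ext i j
  simp [Matrix.mul_apply, mul_comm]

theorem norm_sampleStieltjes_le {n N : ℕ} {z : ℂ} (hz : z.im ≠ 0)
    (A : Matrix (Fin n) (Fin N) ℝ) : ‖sampleStieltjes z A‖ ≤ |z.im|⁻¹ := by
  have h := (isHermitian_smul_map_mul_transpose A).norm_trace_resolvent_le hz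
  rw [Fintype.card_fin] at h
  rw [sampleStieltjes, norm_mul, norm_inv, Complex.norm_natCast]
  rcases Nat.eq_zero_or_pos n with rfl | hn
  · simp
  · rw [inv_mul_le_iff₀ (by exact_mod_cast hn)]
    exact h

theorem norm_sampleStieltjes_sub_le {n N : ℕ} {z : ℂ} (hz : z.im ≠ 0)
    (A B : Matrix (Fin n) (Fin N) ℝ) (s : Finset (Fin n)) (h : ∀ i ∉ s, A i = B i) :
    ‖sampleStieltjes z A - sampleStieltjes z B‖ ≤ 4 * s.card * (n * |z.im|)⁻¹ := by
  have h1 := (isHermitian_smul_map_mul_transpose A).norm_trace_resolvent_sub_le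
    (isHermitian_smul_map_mul_transpose B) hz
  have hr : (((n : ℂ))⁻¹ • ((B * Bᵀ).map Complex.ofReal) -
      ((n : ℂ))⁻¹ • ((A * Aᵀ).map Complex.ofReal)).rank ≤ 2 * s.card := by
    have h2 := Matrix.rank_mul_transpose_sub_le (B.map Complex.ofReal) (A.map Complex.ofReal) s
      fun i hi => by ext j; simp [h i hi]
    have he : ((n : ℂ))⁻¹ • ((B * Bᵀ).map Complex.ofReal) -
        ((n : ℂ))⁻¹ • ((A * Aᵀ).map Complex.ofReal) =
        (((n : ℂ))⁻¹ • (1 : Matrix (Fin n) (Fin n) ℂ)) *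
          (B.map Complex.ofReal * (B.map Complex.ofReal)ᵀ -
          A.map Complex.ofReal * (A.map Complex.ofReal)ᵀ) := by
      rw [Matrix.smul_mul, Matrix.one_mul, ← smul_sub]
      congr 1
      ext i j
      simp [Matrix.mul_apply]
    rw [he]
    exact (Matrix.rank_mul_le_right _ _).trans h2
  rw [sampleStieltjes, sampleStieltjes, ← mul_sub, norm_mul, norm_inv, Complex.norm_natCast,
    mul_inv]
  calc _ ≤ (n : ℝ)⁻¹ * (((2 * s.card : ℕ) : ℝ) * (2 * |z.im|⁻¹)) := by
        gcongr
        exact h1.trans (by gcongr)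
    _ = _ := by push_cast; ring

theorem measurable_sampleStieltjes {n N : ℕ} (z : ℂ) :
    Measurable fun A : Fin n → Fin N → ℝ => sampleStieltjes z (Matrix.of A) := by
  have hcont : Continuous fun A : Fin n → Fin N → ℝ =>
      ((n : ℂ))⁻¹ • ((Matrix.of A * (Matrix.of A)ᵀ).map Complex.ofReal)
        - z • (1 : Matrix (Fin n) (Fin n) ℂ) := by
    have : Continuous fun A : Fin n → Fin N → ℝ => Matrix.of A := continuous_id
    have := this.matrix_mul this.matrix_transpose
    have := this.matrix_map Complex.continuous_ofReal
    exact (this.const_smul ((n : ℂ))⁻¹).sub continuous_const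
  simp only [sampleStieltjes, Matrix.inv_def, Matrix.trace_smul, Ring.inverse_eq_inv',
    smul_eq_mul]
  exact (hcont.matrix_det.measurable.inv.mul
    hcont.matrix_adjugate.matrix_trace.measurable).const_mul _

theorem condExp_comp_prodMk_ae_eq {Ω α γ : Type*} {m m₀ : MeasurableSpace Ω}
    [MeasurableSpace α] [MeasurableSpace γ] {μ : Measure Ω} [IsProbabilityMeasure μ] (hm : m ≤ m₀)
    {U : Ω → α} {V : Ω → γ} (hU : Measurable[m] U) (hV : Measurable V)
    (hind : Indep m (MeasurableSpace.comap V inferInstance) μ)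
    {f : α → γ → ℝ} (hf : Measurable (Function.uncurry f)) {c : ℝ} (hc : ∀ u v, |f u v| ≤ c) :
    μ[fun ω => f (U ω) (V ω) | m] =ᵐ[μ] fun ω => ∫ ω', f (U ω) (V ω') ∂μ := by
  have hU₀ : Measurable U := hU.mono hm le_rfl
  have hgm : Measurable fun u => ∫ ω', f u (V ω') ∂μ := by
    have : Measurable (Function.uncurry fun u ω' => f u (V ω')) :=
      hf.comp (measurable_fst.prodMk (hV.comp measurable_snd))
    exact this.stronglyMeasurable.integral_prod_right.measurable
  have hgc : ∀ u, ‖∫ ω', f u (V ω') ∂μ‖ ≤ c := fun u => by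
    simpa using norm_integral_le_of_norm_le_const (μ := μ) (f := fun ω' => f u (V ω')) (C := c)
      (Filter.Eventually.of_forall fun ω' => hc u (V ω'))
  symm
  refine ae_eq_condExp_of_forall_setIntegral_eq hm ?_ (fun s _ _ => ?_) (fun s hs _ => ?_) ?_
  · exact Integrable.of_bound (hf.comp (hU₀.prodMk hV)).aestronglyMeasurable c
      (Filter.Eventually.of_forall fun ω => hc _ _)
  · exact (Integrable.of_bound (hgm.comp hU₀).aestronglyMeasurable c
      (Filter.Eventually.of_forall fun ω => hgc _)).integrableOn
  · have hs₀ : MeasurableSet s := hm s hs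
    have hI : Measurable[m] (s.indicator (fun _ => (1 : ℝ))) := measurable_const.indicator hs
    have hP : Measurable[m] fun ω => (s.indicator (fun _ => (1 : ℝ)) ω, U ω) := hI.prodMk hU
    have hP₀ : Measurable fun ω => (s.indicator (fun _ => (1 : ℝ)) ω, U ω) := hP.mono hm le_rfl
    have hindf : IndepFun (fun ω => (s.indicator (fun _ => (1 : ℝ)) ω, U ω)) V μ :=
      (IndepFun_iff_Indep _ _ _).mpr (indep_of_indep_of_le_left hind hP.comap_le)
    have hlaw := (indepFun_iff_map_prod_eq_prod_map_map hP₀.aemeasurable hV.aemeasurable).mp hindf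
    have := Measure.isProbabilityMeasure_map (μ := μ) hP₀.aemeasurable
    have := Measure.isProbabilityMeasure_map (μ := μ) hV.aemeasurable
    let F : (ℝ × α) × γ → ℝ := fun p => (Set.Icc 0 1).indicator id p.1.1 * f p.1.2 p.2
    have hF : Measurable F := by
      refine Measurable.mul ?_ ?_
      · exact (measurable_id.indicator measurableSet_Icc).comp
          (measurable_fst.comp measurable_fst)
      · exact hf.comp ((measurable_snd.comp measurable_fst).prodMk measurable_snd)
    have hFc : ∀ p, ‖F p‖ ≤ c := fun p => by
      have h1 : |(Set.Icc (0 : ℝ) 1).indicator id p.1.1| ≤ 1 := by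
        by_cases h : p.1.1 ∈ Set.Icc (0 : ℝ) 1
        · rw [Set.indicator_of_mem h, abs_le]; exact ⟨neg_one_lt_zero.le.trans h.1, h.2⟩
        · rw [Set.indicator_of_notMem h]; simp
      rw [Real.norm_eq_abs, abs_mul]
      exact (mul_le_of_le_one_left (abs_nonneg _) h1).trans (hc _ _)
    have hFs : ∀ ω v, F ((s.indicator (fun _ => (1 : ℝ)) ω, U ω), v) =
        s.indicator (fun ω => f (U ω) v) ω := fun ω v => by
      by_cases h : ω ∈ s <;> simp [F, h]
    have e1 : ∫ ω in s, f (U ω) (V ω) ∂μ = ∫ p, F p ∂(μ.map fun ω =>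
        ((s.indicator (fun _ => (1 : ℝ)) ω, U ω), V ω)) := by
      rw [integral_map (hP₀.prodMk hV).aemeasurable hF.aestronglyMeasurable,
        ← integral_indicator hs₀]
      refine integral_congr_ae (Filter.Eventually.of_forall fun ω => ?_)
      simp only [hFs]
      by_cases h : ω ∈ s <;> simp [h]
    rw [e1, hlaw, integral_prod _ (Integrable.of_bound hF.aestronglyMeasurable c
      (Filter.Eventually.of_forall hFc)), integral_map hP₀.aemeasurable
      hF.stronglyMeasurable.integral_prod_right.aestronglyMeasurable, ← integral_indicator hs₀]
    refine integral_congr_ae (Filter.Eventually.of_forall fun ω => ?_)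
    have := integral_map (μ := μ) (f := fun v => F ((s.indicator (fun _ => (1 : ℝ)) ω, U ω), v)) hV.aemeasurable
      (hF.comp measurable_prodMk_left).aestronglyMeasurable
    refine Eq.trans ?_ this.symm
    simp only [hFs]
    by_cases h : ω ∈ s <;> simp [h]
  · exact (hgm.comp hU).stronglyMeasurable.aestronglyMeasurable

theorem abs_condExp_sub_condExp_le {Ω : Type*} {m₁ m₂ m₀ : MeasurableSpace Ω} {μ : Measure Ω}
    {X Y : Ω → ℝ} (hX : Integrable X μ) (hY : Integrable Y μ) {c : ℝ}
    (hc : ∀ ω, |X ω - Y ω| ≤ c) (hYm : μ[Y | m₁] =ᵐ[μ] μ[Y | m₂]) :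
    ∀ᵐ ω ∂μ, |(μ[X | m₂]) ω - (μ[X | m₁]) ω| ≤ 2 * c := by
  have hb : ∀ᵐ ω ∂μ, |(X - Y) ω| ≤ c := Filter.Eventually.of_forall hc
  filter_upwards [ae_bdd_abs_condExp_of_ae_bdd_abs (m := m₁) hb, ae_bdd_abs_condExp_of_ae_bdd_abs (m := m₂) hb,
    condExp_sub hX hY m₁, condExp_sub hX hY m₂, hYm] with ω h1 h2 h3 h4 h5
  rw [h3, Pi.sub_apply] at h1
  rw [h4, Pi.sub_apply] at h2
  rw [abs_le] at *
  constructor <;> linarith [h1.1, h1.2, h2.1, h2.2]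

/-- A bounded-differences variance estimate along a filtration. -/
theorem variance_condExp_le {Ω : Type*} {m₀ : MeasurableSpace Ω} {μ : Measure Ω}
    [IsProbabilityMeasure μ] (F : ℕ → MeasurableSpace Ω) (hmono : Monotone F)
    (hle : ∀ k, F k ≤ m₀) (hbot : F 0 = ⊥) {X : Ω → ℝ} (hX : MemLp X 2 μ) {c : ℝ} {n : ℕ}
    (hinc : ∀ k < n, ∀ᵐ ω ∂μ, |(μ[X | F (k + 1)]) ω - (μ[X | F k]) ω| ≤ c) :
    Var[μ[X | F n]; μ] ≤ n * c ^ 2 := by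
  induction n with
  | zero => simp [hbot, condExp_bot, variance_eq_integral]
  | succ n ih =>
    have hY : MemLp (μ[X | F (n + 1)]) 2 μ := hX.condExp one_le_two
    have htower : μ[μ[X | F (n + 1)] | F n] =ᵐ[μ] μ[X | F n] :=
      condExp_condExp_of_le (hmono n.le_succ) (hle _)
    have hZ : MemLp (μ[X | F (n + 1)] - μ[μ[X | F (n + 1)] | F n]) 2 μ :=
      hY.sub (hY.condExp one_le_two)
    have h1 : ∫ ω, (Var[μ[X | F (n + 1)]; μ | F n]) ω ∂μ ≤ c ^ 2 := by
      rw [condVar, integral_condExp (hle n)]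
      have : ∫ _, c ^ 2 ∂μ = c ^ 2 := by simp
      rw [← this]
      refine integral_mono_ae hZ.integrable_sq (integrable_const _) ?_
      filter_upwards [hinc n n.lt_succ_self, htower] with ω h2 h3
      simp only [Pi.pow_apply, Pi.sub_apply, h3]
      exact sq_le_sq' (abs_le.mp h2).1 (abs_le.mp h2).2
    rw [← integral_condVar_add_variance_condExp (hle n) hY, variance_congr htower]
    push_cast
    linarith [ih fun k hk => hinc k (hk.trans n.lt_succ_self)]

theorem variance_le_of_dependent_rows {n β : ℕ} {Ω E : Type*} [MeasurableSpace E] [Inhabited E]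
    {m₀ : MeasurableSpace Ω} {μ : Measure Ω} [IsProbabilityMeasure μ] {A : Ω → Fin n → E}
    (hA : ∀ i, Measurable fun ω => A ω i)
    (hind : ∀ s t : Finset (Fin n), (∀ i ∈ s, ∀ j ∈ t, (β : ℤ) < |(i : ℤ) - (j : ℤ)|) →
      Indep (⨆ i ∈ s, MeasurableSpace.comap (fun ω => A ω i) inferInstance)
        (⨆ j ∈ t, MeasurableSpace.comap (fun ω => A ω j) inferInstance) μ)
    {φ : (Fin n → E) → ℝ} (hφ : Measurable φ) {b c : ℝ} (hb : ∀ x, |φ x| ≤ b)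
    (hc : ∀ (s : Finset (Fin n)) (x y : Fin n → E), s.card ≤ β + 1 → (∀ i ∉ s, x i = y i) →
      |φ x - φ y| ≤ c) :
    Var[fun ω => φ (A ω); μ] ≤ n * (2 * c) ^ 2 := by
  let G : Finset (Fin n) → MeasurableSpace Ω := fun s =>
    ⨆ i ∈ s, MeasurableSpace.comap (fun ω => A ω i) inferInstance
  have hGm : ∀ s, ∀ i ∈ s, Measurable[G s] fun ω => A ω i := fun s i hi =>
    (comap_measurable _).mono
      (le_iSup₂ (f := fun i (_ : i ∈ s) =>
        MeasurableSpace.comap (fun ω => A ω i) inferInstance) i hi) le_rfl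
  have hGmask : ∀ (s : Finset (Fin n)) (p : Fin n → Prop) [DecidablePred p], (∀ i, p i → i ∈ s) →
      Measurable[G s] fun ω (i : Fin n) => if p i then A ω i else default := by
    intro s p _ hp
    refine @measurable_pi_lambda _ _ _ (G s) _ _ fun i => ?_
    by_cases h : p i
    · simpa only [h, if_true] using hGm s i (hp i h)
    · simp only [h, if_false]
      exact @measurable_const _ _ _ (G s) _
  have hGle : ∀ s, G s ≤ m₀ := fun s => iSup₂_le fun i _ => (hA i).comap_le
  have hGmono : Monotone G := fun s t hst => biSup_mono fun i hi => hst hi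
  let F : ℕ → MeasurableSpace Ω := fun k => G (Finset.univ.filter fun i => i.val < k)
  have hFmono : Monotone F := fun k l hkl => hGmono fun i => by
    simp only [Finset.mem_filter, Finset.mem_univ, true_and]
    omega
  have hX : Measurable fun ω => φ (A ω) := hφ.comp (measurable_pi_lambda _ hA)
  have hXb : MemLp (fun ω => φ (A ω)) 2 μ :=
    MemLp.of_bound hX.aestronglyMeasurable b (Filter.Eventually.of_forall fun ω => hb _)
  have hXn : μ[fun ω => φ (A ω) | F n] = fun ω => φ (A ω) := by
    refine condExp_of_stronglyMeasurable (hGle _) (Measurable.stronglyMeasurable ?_)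
      (hXb.integrable one_le_two)
    refine hφ.comp (@measurable_pi_lambda _ _ _ (F n) _ _ fun i => hGm _ i ?_)
    simp
  rw [← hXn]
  refine variance_condExp_le F hFmono (fun k => hGle _) (by simp [F, G]) hXb fun k hk => ?_
  let U : Ω → Fin n → E := fun ω i => if i.val < k then A ω i else default
  let V : Ω → Fin n → E := fun ω i => if k + β < i.val then A ω i else default
  let f : (Fin n → E) → (Fin n → E) → ℝ := fun u v => φ fun i => if i.val < k then u i else v i
  have hU : Measurable[F k] U := hGmask _ (fun i => i.val < k) (by simp)
  have hV : Measurable[G (Finset.univ.filter fun i => k + β < i.val)] V :=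
    hGmask _ (fun i => k + β < i.val) (by simp)
  have hf : Measurable (Function.uncurry f) := by
    refine hφ.comp (measurable_pi_lambda _ fun i => ?_)
    by_cases h : i.val < k
    · simp only [h, if_true]
      exact (measurable_pi_apply i).comp measurable_fst
    · simp only [h, if_false]
      exact (measurable_pi_apply i).comp measurable_snd
  have hindV : Indep (F (k + 1)) (MeasurableSpace.comap V inferInstance) μ := by
    refine indep_of_indep_of_le_right (hind _ (Finset.univ.filter fun i => k + β < i.val) ?_)
      hV.comap_le
    intro i hi j hj
    simp only [Finset.mem_filter, Finset.mem_univ, true_and] at hi hj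
    rw [lt_abs]
    omega
  have hV₀ : Measurable V := hV.mono (hGle _) le_rfl
  have hU₀ : Measurable U := hU.mono (hGle _) le_rfl
  have hY : Integrable (fun ω => f (U ω) (V ω)) μ :=
    Integrable.of_bound (hf.comp (hU₀.prodMk hV₀)).aestronglyMeasurable b
      (Filter.Eventually.of_forall fun ω => hb _)
  refine abs_condExp_sub_condExp_le (hXb.integrable one_le_two) hY (fun ω => ?_)
    ((condExp_comp_prodMk_ae_eq (hGle _) hU hV₀
      (indep_of_indep_of_le_left hindV (hFmono k.le_succ)) hf fun u v => hb _).trans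
    (condExp_comp_prodMk_ae_eq (hGle _) (hU.mono (hFmono k.le_succ) le_rfl) hV₀ hindV hf
      fun u v => hb _).symm)
  refine hc (Finset.univ.filter fun i => k ≤ i.val ∧ i.val ≤ k + β) _ _ ?_ fun i hi => ?_
  · rw [← Finset.card_map Fin.valEmbedding]
    refine (Finset.card_le_card (t := Finset.Icc k (k + β)) fun x hx => ?_).trans ?_
    · simp only [Finset.mem_map, Finset.mem_filter, Finset.mem_univ, true_and] at hx
      obtain ⟨i, hi, rfl⟩ := hx
      exact Finset.mem_Icc.mpr hi
    · rw [Nat.card_Icc]; omega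
  · simp only [Finset.mem_filter, Finset.mem_univ, true_and] at hi
    by_cases h : i.val < k
    · simp [U, h]
    · have h' : k + β < i.val := by omega
      simp [V, h, h']

theorem integral_norm_sub_integral_sq_eq {Ω : Type*} {m₀ : MeasurableSpace Ω} {μ : Measure Ω}
    [IsProbabilityMeasure μ] {X : Ω → ℂ} (hX : MemLp X 2 μ) :
    ∫ ω, ‖X ω - ∫ ω', X ω' ∂μ‖ ^ 2 ∂μ =
      Var[fun ω => (X ω).re; μ] + Var[fun ω => (X ω).im; μ] := by
  have hi : Integrable X μ := hX.integrable one_le_two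
  have hre : MemLp (fun ω => (X ω).re) 2 μ := hX.re
  have him : MemLp (fun ω => (X ω).im) 2 μ := hX.im
  have ere : (∫ ω, X ω ∂μ).re = ∫ ω, (X ω).re ∂μ := (integral_re hi).symm
  have eim : (∫ ω, X ω ∂μ).im = ∫ ω, (X ω).im ∂μ := (integral_im hi).symm
  rw [variance_eq_integral hre.aemeasurable, variance_eq_integral him.aemeasurable,
    ← integral_add]
  · refine integral_congr_ae (Filter.Eventually.of_forall fun ω => ?_)
    dsimp only
    rw [Complex.sq_norm, Complex.normSq_apply, Complex.sub_re, Complex.sub_im, ere, eim]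
    ring
  · exact (hre.sub (memLp_const _)).integrable_sq
  · exact (him.sub (memLp_const _)).integrable_sq

/-- Variance bound for the Stieltjes transform of the ESD of `A Aᵀ / n` under the
`β`-dependence condition on the rows of `A` (Lemma A.1): there is an absolute
constant `C > 0` such that whenever the σ-algebras generated by two families of rows
of `A` are independent as soon as all pairs of row indices are more than `β` apart,
one has, for every `z` with `Im z ≠ 0`,
`Var[(1/n) Tr (A Aᵀ/n - z I)⁻¹] ≤ C (β+1)²/(n (Im z)²)`. -/
theorem variance_stieltjes_transform_dependent_rows :
    ∃ C : ℝ, 0 < C ∧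
      ∀ (n N β : ℕ) (Ω : Type) (_ : MeasurableSpace Ω) (μ : Measure Ω),
        IsProbabilityMeasure μ →
        ∀ A : Ω → Matrix (Fin n) (Fin N) ℝ, (∀ i j, Measurable fun ω => A ω i j) →
        (∀ s t : Finset (Fin n),
          (∀ i ∈ s, ∀ j ∈ t, (β : ℤ) < |(i : ℤ) - (j : ℤ)|) →
          Indep (⨆ i ∈ s, MeasurableSpace.comap (fun ω => A ω i) inferInstance)
            (⨆ j ∈ t, MeasurableSpace.comap (fun ω => A ω j) inferInstance) μ) →
        ∀ z : ℂ, z.im ≠ 0 →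
          (∫ ω, ‖((n : ℂ))⁻¹ *
                (((n : ℂ))⁻¹ • (((A ω) * (A ω)ᵀ).map Complex.ofReal)
                    - z • (1 : Matrix (Fin n) (Fin n) ℂ))⁻¹.trace -
              ∫ ω', ((n : ℂ))⁻¹ *
                (((n : ℂ))⁻¹ • (((A ω') * (A ω')ᵀ).map Complex.ofReal)
                    - z • (1 : Matrix (Fin n) (Fin n) ℂ))⁻¹.trace ∂μ‖ ^ 2 ∂μ) ≤
            C * ((β : ℝ) + 1) ^ 2 / (n * z.im ^ 2) := by
  refine ⟨128, by norm_num, fun n N β Ω _ μ _ A hA hind z hz => ?_⟩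
  change ∫ ω, ‖sampleStieltjes z (A ω) - ∫ ω', sampleStieltjes z (A ω') ∂μ‖ ^ 2 ∂μ ≤ _
  have hrow : ∀ i, Measurable fun ω => A ω i := fun i => measurable_pi_lambda _ (hA i)
  have hm := measurable_sampleStieltjes (n := n) (N := N) z
  have hX : MemLp (fun ω => sampleStieltjes z (A ω)) 2 μ :=
    MemLp.of_bound (hm.comp (measurable_pi_lambda _ hrow)).aestronglyMeasurable |z.im|⁻¹
      (Filter.Eventually.of_forall fun ω => norm_sampleStieltjes_le hz _)
  have hdiff : ∀ (s : Finset (Fin n)) (x y : Fin n → Fin N → ℝ), s.card ≤ β + 1 →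
      (∀ i ∉ s, x i = y i) → ‖sampleStieltjes z (Matrix.of x) - sampleStieltjes z (Matrix.of y)‖ ≤
        4 * (β + 1) * (n * |z.im|)⁻¹ := fun s x y hs h => by
    refine (norm_sampleStieltjes_sub_le hz _ _ s h).trans ?_
    gcongr
    exact_mod_cast hs
  have hre := variance_le_of_dependent_rows hrow hind (Complex.measurable_re.comp hm)
    (fun x => (Complex.abs_re_le_norm _).trans (norm_sampleStieltjes_le hz _))
    fun s x y hs h => (Complex.abs_re_le_norm _).trans (hdiff s x y hs h)
  have him := variance_le_of_dependent_rows hrow hind (Complex.measurable_im.comp hm)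
    (fun x => (Complex.abs_im_le_norm _).trans (norm_sampleStieltjes_le hz _))
    fun s x y hs h => (Complex.abs_im_le_norm _).trans (hdiff s x y hs h)
  rw [integral_norm_sub_integral_sq_eq hX]
  refine (add_le_add hre him).trans_eq ?_
  rw [← sq_abs z.im]
  rcases Nat.eq_zero_or_pos n with rfl | hn
  · simp
  · have := abs_pos.mpr hz
    field_simp
    ring
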